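/- Let Λ ∈ ℝ^{r×r} be a diagonal matrix with diagonal entries λ_j satisfying 0 ≤ λ_j ≤ λ_max for all j. Define G(W) = 2(Λ W − Tr(Wᵀ Λ W) W) for W ∈ ℝ^{r×d}. Then for all W_1, W_2 ∈ ℝ^{r×d} with Frobenius norm ‖W_1‖_F = ‖W_2‖_F = 1, one has ‖G(W_1) − G(W_2)‖_F ≤ 8 λ_max ‖W_1 − W_2‖_F; i.e., the gradient of the spectral Rayleigh regularizer restricted to the unit Frobenius sphere is Lipschitz with constant at most 8 λ_max. -/

import Mathlib

open Matrix

/-- The Frobenius norm of a real matrix. -/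
noncomputable def frobNorm {a b : Type*} [Fintype a] [Fintype b]
    (M : Matrix a b ℝ) : ℝ :=
  Real.sqrt (∑ i, ∑ j, M i j ^ 2)

theorem frobNorm_sq {a b : Type*} [Fintype a] [Fintype b] (M : Matrix a b ℝ) :
    frobNorm M ^ 2 = ∑ p : a × b, M p.1 p.2 ^ 2 := by
  rw [frobNorm, Real.sq_sqrt (by positivity), Fintype.sum_prod_type]

theorem trace_transpose_mul_diagonal_mul {a b : Type*} [Fintype a] [Fintype b] [DecidableEq a]
    (l : a → ℝ) (W : Matrix a b ℝ) :
    (Wᵀ * Matrix.diagonal l * W).trace = ∑ p : a × b, l p.1 * W p.1 p.2 ^ 2 := by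
  simp only [Matrix.trace, Matrix.diag_apply, Matrix.mul_apply (M := Wᵀ * Matrix.diagonal l),
    Matrix.mul_diagonal, Matrix.transpose_apply]
  rw [Fintype.sum_prod_type, Finset.sum_comm]
  exact Finset.sum_congr rfl fun i _ => Finset.sum_congr rfl fun j _ => by ring

/-- Weighted sums of squares of unit vectors, with weights in `[0, L]`, differ by at most
`2 * L` times the distance of the vectors. -/
theorem sq_sum_mul_sq_sub_le {ι : Type*} [Fintype ι] {l x y : ι → ℝ} {L : ℝ}
    (hl : ∀ i, 0 ≤ l i ∧ l i ≤ L) (hx : ∑ i, x i ^ 2 = 1) (hy : ∑ i, y i ^ 2 = 1) :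
    (∑ i, l i * x i ^ 2 - ∑ i, l i * y i ^ 2) ^ 2 ≤ 4 * L ^ 2 * ∑ i, (x i - y i) ^ 2 := by
  have hsplit : ∑ i, l i * x i ^ 2 - ∑ i, l i * y i ^ 2
      = ∑ i, (l i * (x i - y i)) * (x i + y i) := by
    rw [← Finset.sum_sub_distrib]
    exact Finset.sum_congr rfl fun i _ => by ring
  have hdiff : ∑ i, (l i * (x i - y i)) ^ 2 ≤ L ^ 2 * ∑ i, (x i - y i) ^ 2 := by
    rw [Finset.mul_sum]
    refine Finset.sum_le_sum fun i _ => ?_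
    rw [mul_pow]
    exact mul_le_mul_of_nonneg_right (pow_le_pow_left₀ (hl i).1 (hl i).2 2) (sq_nonneg _)
  have hadd : ∑ i, (x i + y i) ^ 2 ≤ 4 := by
    calc ∑ i, (x i + y i) ^ 2 ≤ ∑ i, (2 * x i ^ 2 + 2 * y i ^ 2) :=
          Finset.sum_le_sum fun i _ => by nlinarith [sq_nonneg (x i - y i)]
      _ = 4 := by
          rw [Finset.sum_add_distrib, ← Finset.mul_sum, ← Finset.mul_sum, hx, hy]
          norm_num
  rw [hsplit]
  calc (∑ i, (l i * (x i - y i)) * (x i + y i)) ^ 2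
      ≤ (∑ i, (l i * (x i - y i)) ^ 2) * ∑ i, (x i + y i) ^ 2 :=
        Finset.sum_mul_sq_le_sq_mul_sq _ _ _
    _ ≤ (L ^ 2 * ∑ i, (x i - y i) ^ 2) * 4 := by gcongr
    _ = 4 * L ^ 2 * ∑ i, (x i - y i) ^ 2 := by ring

/-- The gradient `G(W) = 2(Λ W - Tr(Wᵀ Λ W) W)` of the spectral Rayleigh regularizer is
Lipschitz on the unit Frobenius sphere with constant at most `8 λ_max`, when `Λ` is diagonal
with entries in `[0, λ_max]`. -/
theorem rayleigh_gradient_lipschitz {r d : ℕ}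
    (lam : Fin r → ℝ) (lamMax : ℝ)
    (hlam : ∀ j, 0 ≤ lam j ∧ lam j ≤ lamMax)
    (Λ : Matrix (Fin r) (Fin r) ℝ) (hΛ : Λ = Matrix.diagonal lam)
    (G : Matrix (Fin r) (Fin d) ℝ → Matrix (Fin r) (Fin d) ℝ)
    (hG : ∀ W, G W = (2 : ℝ) • (Λ * W - (Wᵀ * Λ * W).trace • W)) :
    ∀ W₁ W₂ : Matrix (Fin r) (Fin d) ℝ, frobNorm W₁ = 1 → frobNorm W₂ = 1 →
      frobNorm (G W₁ - G W₂) ≤ 8 * lamMax * frobNorm (W₁ - W₂) := by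
  intro W₁ W₂ h₁ h₂
  have hx : ∑ p : Fin r × Fin d, W₁ p.1 p.2 ^ 2 = 1 := by rw [← frobNorm_sq, h₁, one_pow]
  have hy : ∑ p : Fin r × Fin d, W₂ p.1 p.2 ^ 2 = 1 := by rw [← frobNorm_sq, h₂, one_pow]
  have hL : 0 ≤ lamMax := by
    by_contra hneg
    have : IsEmpty (Fin r) := ⟨fun j => hneg ((hlam j).1.trans (hlam j).2)⟩
    simp at hx
  have hs := sq_sum_mul_sq_sub_le (fun p : Fin r × Fin d => hlam p.1) hx hy
  have htr : ∀ W : Matrix (Fin r) (Fin d) ℝ,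
      (Wᵀ * Λ * W).trace = ∑ p : Fin r × Fin d, lam p.1 * W p.1 p.2 ^ 2 := fun W => by
    rw [hΛ, trace_transpose_mul_diagonal_mul]
  have ht0 : 0 ≤ (W₁ᵀ * Λ * W₁).trace := by
    rw [htr]
    exact Finset.sum_nonneg fun p _ => mul_nonneg (hlam p.1).1 (sq_nonneg _)
  have htL : (W₁ᵀ * Λ * W₁).trace ≤ lamMax := by
    rw [htr, ← mul_one lamMax, ← hx, Finset.mul_sum]
    exact Finset.sum_le_sum fun p _ => mul_le_mul_of_nonneg_right (hlam p.1).2 (sq_nonneg _)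
  rw [← htr, ← htr] at hs
  have hG' : ∀ (W : Matrix (Fin r) (Fin d) ℝ) i j,
      G W i j = 2 * (lam i * W i j - (Wᵀ * Λ * W).trace * W i j) := fun W i j => by
    rw [hG, Matrix.smul_apply, Matrix.sub_apply, Matrix.smul_apply]
    simp only [smul_eq_mul]
    congr 2
    rw [hΛ, Matrix.diagonal_mul]
  set t₁ := (W₁ᵀ * Λ * W₁).trace
  set t₂ := (W₂ᵀ * Λ * W₂).trace
  refine le_of_sq_le_sq ?_ (mul_nonneg (by positivity) (Real.sqrt_nonneg _))
  rw [mul_pow, frobNorm_sq, frobNorm_sq]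
  simp only [Matrix.sub_apply, hG']
  have hD : 0 ≤ ∑ p : Fin r × Fin d, (W₁ p.1 p.2 - W₂ p.1 p.2) ^ 2 := by positivity
  calc ∑ p : Fin r × Fin d, (2 * (lam p.1 * W₁ p.1 p.2 - t₁ * W₁ p.1 p.2)
          - 2 * (lam p.1 * W₂ p.1 p.2 - t₂ * W₂ p.1 p.2)) ^ 2
      ≤ ∑ p : Fin r × Fin d, (8 * lamMax ^ 2 * (W₁ p.1 p.2 - W₂ p.1 p.2) ^ 2
          + 8 * (t₁ - t₂) ^ 2 * W₂ p.1 p.2 ^ 2) := by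
        refine Finset.sum_le_sum fun p _ => ?_
        have hl : (lam p.1 - t₁) ^ 2 ≤ lamMax ^ 2 :=
          sq_le_sq' (by linarith [(hlam p.1).1]) (by linarith [(hlam p.1).2])
        have hm := mul_le_mul_of_nonneg_right hl (sq_nonneg (W₁ p.1 p.2 - W₂ p.1 p.2))
        linarith [sq_nonneg ((lam p.1 - t₁) * (W₁ p.1 p.2 - W₂ p.1 p.2)
          + (t₁ - t₂) * W₂ p.1 p.2)]
    _ = 8 * lamMax ^ 2 * ∑ p : Fin r × Fin d, (W₁ p.1 p.2 - W₂ p.1 p.2) ^ 2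
          + 8 * (t₁ - t₂) ^ 2 := by
        rw [Finset.sum_add_distrib, ← Finset.mul_sum, ← Finset.mul_sum, hy, mul_one]
    _ ≤ (8 * lamMax) ^ 2 * ∑ p : Fin r × Fin d, (W₁ p.1 p.2 - W₂ p.1 p.2) ^ 2 := by
        linarith [mul_nonneg (sq_nonneg lamMax) hD]
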